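/- Let Ω be a finite set partitioned into blocks b_1,...,b_m, each assigned a rank rk(b_i) ∈ ℕ, with positive real weights constant on each block. Then for infinite sets b̄_i interpreting the blocks, the set Λ of finite subsets λ of ⋃ b̄_i satisfying (1) |b̄_i ∩ λ| = |b̄_j ∩ λ| whenever rk(b_i) = rk(b_j), and (2) |b̄_i ∩ λ| > |b̄_j ∩ λ|² whenever rk(b_i) < rk(b_j), is a directed set under inclusion whose union is Ω: every two elements of Λ have a common superset in Λ, and every point of Ω belongs to some λ ∈ Λ. -/

import Mathlib

open scoped Classical

theorem exists_forall_sq_lt_of_lt (N R : ℕ) :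
    ∃ f : ℕ → ℕ, (∀ r, N ≤ f r) ∧ ∀ r r', r < r' → r' ≤ R → f r' ^ 2 < f r := by
  let g : ℕ → ℕ := fun k => Nat.rec N (fun _ a => a ^ 2 + 1) k
  have hg : ∀ k, g (k + 1) = g k ^ 2 + 1 := fun _ => rfl
  have hmono : Monotone g := monotone_nat_of_le_succ fun k => by
    rw [hg]; nlinarith [Nat.le_self_pow two_ne_zero (g k)]
  refine ⟨fun r => g (R - r), fun r => hmono (Nat.zero_le (R - r)), fun r r' h h' => ?_⟩
  have h1 : g (R - r' + 1) ≤ g (R - r) :=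
    hmono (show R - r' + 1 ≤ R - r by omega)
  rw [hg] at h1
  exact h1

theorem Set.Infinite.exists_finset_superset_card_eq {α : Type*} {b : Set α} (hb : b.Infinite)
    {s : Finset α} (hs : ↑s ⊆ b) {n : ℕ} (hn : s.card ≤ n) :
    ∃ t : Finset α, s ⊆ t ∧ ↑t ⊆ b ∧ t.card = n := by
  obtain ⟨u, hu, huc⟩ := (hb.sdiff s.finite_toSet).exists_subset_card_eq (n - s.card)
  have hd : Disjoint s u := Finset.disjoint_left.2 fun x hx hxu => (hu hxu).2 hx
  refine ⟨s ∪ u, Finset.subset_union_left, fun x hx => ?_, ?_⟩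
  · rcases Finset.mem_union.1 hx with h | h
    exacts [hs h, (hu h).1]
  · rw [Finset.card_union_of_disjoint hd, huc]
    omega

theorem exists_finset_superset_forall_card_filter_eq {Ω ι : Type*} [Fintype ι] {b : ι → Set Ω}
    (hdisj : ∀ i j, i ≠ j → Disjoint (b i) (b j)) (hinf : ∀ i, (b i).Infinite)
    (hcover : ⋃ i, b i = Set.univ) (s : Finset Ω) {n : ι → ℕ} (hn : ∀ i, s.card ≤ n i) :
    ∃ l : Finset Ω, s ⊆ l ∧ ∀ i, (l.filter (· ∈ b i)).card = n i := by
  have ht (i : ι) : ∃ t : Finset Ω, s.filter (· ∈ b i) ⊆ t ∧ ↑t ⊆ b i ∧ t.card = n i :=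
    (hinf i).exists_finset_superset_card_eq (fun x hx => (Finset.mem_filter.1 hx).2)
      ((Finset.card_filter_le _ _).trans (hn i))
  choose t hst htb htc using ht
  refine ⟨Finset.univ.biUnion t, fun x hx => ?_, fun i => ?_⟩
  · obtain ⟨i, hi⟩ := Set.mem_iUnion.1 (hcover ▸ Set.mem_univ x)
    exact Finset.mem_biUnion.2
      ⟨i, Finset.mem_univ i, hst i (Finset.mem_filter.2 ⟨hx, hi⟩)⟩
  · rw [← htc i]
    congr 1
    ext x
    simp only [Finset.mem_filter, Finset.mem_biUnion, Finset.mem_univ, true_and]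
    refine ⟨fun ⟨⟨j, hj⟩, hi⟩ => ?_, fun h => ⟨⟨i, h⟩, htb i h⟩⟩
    by_cases hij : j = i
    · exact hij ▸ hj
    · exact (Set.disjoint_left.1 (hdisj j i hij) (htb j hj) hi).elim

/-- The family of finite test sets respecting the rank-cardinality conditions:
(1) blocks of equal rank meet `λ` in sets of equal size, and
(2) a block of strictly lower rank meets `λ` in more than the square of the size
of the intersection with a block of higher rank. This family is directed under
inclusion and its union is all of `Ω`. -/
theorem stmt13 {Ω : Type*} (m : ℕ) (bbar : Fin m → Set Ω)
    (hdisj : ∀ i j : Fin m, i ≠ j → Disjoint (bbar i) (bbar j))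
    (hinf : ∀ i : Fin m, (bbar i).Infinite)
    (hcover : (⋃ i : Fin m, bbar i) = Set.univ)
    (rk : Fin m → ℕ)
    (c : Fin m → ℝ) (hc : ∀ i : Fin m, 0 < c i)
    (Λ : Set (Finset Ω))
    (hΛ : Λ = {l : Finset Ω |
      (∀ i j : Fin m, rk i = rk j →
        (l.filter (· ∈ bbar i)).card = (l.filter (· ∈ bbar j)).card) ∧
      (∀ i j : Fin m, rk i < rk j →
        (l.filter (· ∈ bbar j)).card ^ 2 < (l.filter (· ∈ bbar i)).card)}) :
    (∀ l₁ ∈ Λ, ∀ l₂ ∈ Λ, ∃ l₃ ∈ Λ, l₁ ⊆ l₃ ∧ l₂ ⊆ l₃) ∧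
    (∀ x : Ω, ∃ l ∈ Λ, x ∈ l) := by
  have key (s : Finset Ω) : ∃ l ∈ Λ, s ⊆ l := by
    obtain ⟨f, hf, hlt⟩ := exists_forall_sq_lt_of_lt s.card (Finset.univ.sup rk)
    obtain ⟨l, hsl, hl⟩ := exists_finset_superset_forall_card_filter_eq hdisj hinf hcover s
      (n := fun i => f (rk i)) fun i => hf _
    refine ⟨l, ?_, hsl⟩
    rw [hΛ]
    refine ⟨fun i j h => ?_, fun i j h => ?_⟩
    · rw [hl, hl, h]
    · rw [hl, hl]
      exact hlt _ _ h (Finset.le_sup (Finset.mem_univ j))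
  refine ⟨fun l₁ _ l₂ _ => ?_, fun x => ?_⟩
  · obtain ⟨l, hl, hs⟩ := key (l₁ ∪ l₂)
    exact ⟨l, hl, Finset.union_subset_iff.1 hs⟩
  · obtain ⟨l, hl, hs⟩ := key {x}
    exact ⟨l, hl, Finset.singleton_subset_iff.1 hs⟩
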